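/- arXiv:2104.10134 — 8 statements merged into one kernel-verified Lean document; each statement's English description precedes it below -/
import Mathlib

section
/- (Dominant strategy truthfulness of SEAM, Theorem 1.) Fix a movement i ∈ M with ρ_i > 0, a true valuation profile v (all entries nonnegative) and a misreported valuation vector v'_i ≥ 0 for movement i; let v' denote the profile obtained from v by replacing row i with v'_i. Let x* be any integral allocation maximizing W(v, ·) over integral allocations, and let x' be any integral allocation maximizing W(v', ·) over integral allocations. Let p_i(v) be the SEAM payment of i computed from the profile v and allocation x*, and let p_i(v') be the SEAM payment of i computed from the profile v' and allocation x' (note v'_k = v_k for k ≠ i, so h_i(v'_{−i}) = h_i(v_{−i})). Then v_i(x*) − p_i(v) ≥ v_i(x') − p_i(v'), i.e., truthful reporting maximizes movement i's quasi-linear utility irrespective of the other movements' reports. -/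
open Finset

variable {M S : Type*} [Fintype M] [Fintype S]

/-- A fractional allocation of movements to slots. -/
def IsAlloc (C : S → ℕ) (x : M → S → ℝ) : Prop :=
  (∀ i j, 0 ≤ x i j) ∧ (∀ i, ∑ j, x i j ≤ 1) ∧ (∀ j, ∑ i, x i j ≤ (C j : ℝ))

/-- An allocation is integral if every entry is 0 or 1. -/
def IsIntegralAlloc (x : M → S → ℝ) : Prop := ∀ i j, x i j = 0 ∨ x i j = 1

/-- Congestion of slot `j` under allocation `x`: `e_j(x) = max(Σ_i x_{ij} - T_j, 0)`. -/
noncomputable def cong (T : S → ℕ) (x : M → S → ℝ) (j : S) : ℝ :=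
  max (∑ i, x i j - (T j : ℝ)) 0

/-- Affine social welfare `W(v, x) = Σ_j Σ_i ρ_i v_{ij} x_{ij} - g Σ_j e_j(x)`. -/
noncomputable def W (ρ : M → ℝ) (g : ℝ) (T : S → ℕ) (v x : M → S → ℝ) : ℝ :=
  (∑ j, ∑ i, ρ i * v i j * x i j) - g * ∑ j, cong T x j

/-- Movement `i`'s value under allocation `x`: `v_i(x) = Σ_j v_{ij} x_{ij}`. -/
def val (v x : M → S → ℝ) (i : M) : ℝ := ∑ j, v i j * x i j

/-- Welfare splits into the weighted value of movement `i` and the welfare of the others. -/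
lemma W_eq_mul_val_add [DecidableEq M] (ρ : M → ℝ) (g : ℝ) (T : S → ℕ) (v x : M → S → ℝ)
    (i : M) :
    W ρ g T v x = ρ i * val v x i +
      ((∑ k ∈ Finset.univ.erase i, ρ k * val v x k) - g * ∑ j, cong T x j) := by
  have hsum : ∑ j, ∑ k, ρ k * v k j * x k j = ∑ k, ρ k * val v x k := by
    rw [Finset.sum_comm]
    simp only [_root_.val, Finset.mul_sum, mul_assoc]
  rw [W, hsum, ← Finset.add_sum_erase _ _ (Finset.mem_univ i), add_sub_assoc]

/-- Theorem 1 (SEAM is dominant strategy truthful): truthful reporting maximizes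
movement `i`'s quasi-linear utility irrespective of the other movements' reports. -/
theorem seam_dominant_strategy_truthful
    [Nonempty M] [DecidableEq M]
    (C T : S → ℕ) (hTC : ∀ j, T j ≤ C j) (g : ℝ) (hg : 0 ≤ g)
    (ρ : M → ℝ) (hρ : ∀ k, 0 ≤ ρ k)
    (v : M → S → ℝ) (hv : ∀ k j, 0 ≤ v k j)
    (i : M) (hρi : 0 < ρ i)
    (vi' : S → ℝ) (hvi' : ∀ j, 0 ≤ vi' j)
    (v' : M → S → ℝ) (hv' : v' = Function.update v i vi')
    (h : ℝ)
    (hh : IsGreatest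
      {w : ℝ | ∃ x : M → S → ℝ, IsIntegralAlloc x ∧ IsAlloc C x ∧ (∀ j, x i j = 0) ∧ W ρ g T v x = w} h)
    (xstar : M → S → ℝ) (hx1 : IsIntegralAlloc xstar) (hx2 : IsAlloc C xstar)
    (hopt : ∀ x : M → S → ℝ, IsIntegralAlloc x → IsAlloc C x → W ρ g T v x ≤ W ρ g T v xstar)
    (x' : M → S → ℝ) (hx1' : IsIntegralAlloc x') (hx2' : IsAlloc C x')
    (hopt' : ∀ x : M → S → ℝ, IsIntegralAlloc x → IsAlloc C x → W ρ g T v' x ≤ W ρ g T v' x')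
    (p p' : ℝ)
    (hp : p = (1 / ρ i) *
      (h - ((∑ k ∈ Finset.univ.erase i, ρ k * val v xstar k) - g * ∑ j, cong T xstar j)))
    (hp' : p' = (1 / ρ i) *
      (h - ((∑ k ∈ Finset.univ.erase i, ρ k * val v' x' k) - g * ∑ j, cong T x' j))) :
    val v x' i - p' ≤ val v xstar i - p := by
  have hothers : ∑ k ∈ Finset.univ.erase i, ρ k * val v' x' k
      = ∑ k ∈ Finset.univ.erase i, ρ k * val v x' k :=
    Finset.sum_congr rfl fun k hk => by
      simp only [_root_.val, hv', Function.update_of_ne (Finset.ne_of_mem_erase hk)]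
  have hutility : ∀ x : M → S → ℝ, val v x i - (1 / ρ i) *
      (h - ((∑ k ∈ Finset.univ.erase i, ρ k * val v x k) - g * ∑ j, cong T x j))
      = (W ρ g T v x - h) / ρ i := fun x => by
    rw [W_eq_mul_val_add ρ g T v x i]
    field_simp
    ring
  rw [hp, hp', hothers, hutility, hutility]
  have hW := hopt x' hx1' hx2'
  gcongr
end

section
/- (Individual rationality of SEAM, Theorem 2.) For every valuation profile v with all entries v_{ij} ≥ 0, every movement i ∈ M, and any integral allocation x* maximizing W(v, ·) over integral allocations, the quasi-linear utility of movement i is nonnegative: v_i(x*) − p_i ≥ 0, where p_i is the SEAM payment of i computed from v and x*. -/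
open Finset

variable {M S : Type*} [Fintype M] [Fintype S]

/-- Welfare is the weighted sum of all movements' values, net of the congestion cost. -/
theorem W_eq_sum_val_sub_cong (ρ : M → ℝ) (g : ℝ) (T : S → ℕ) (v x : M → S → ℝ) :
    W ρ g T v x = ∑ k, ρ k * val v x k - g * ∑ j, cong T x j := by
  rw [W, Finset.sum_comm]
  simp only [_root_.val, Finset.mul_sum, mul_assoc]

/-- Theorem 2 (SEAM is individually rational): every movement's quasi-linear utility
under SEAM is nonnegative. -/
theorem seam_individually_rational
    [Nonempty M] [DecidableEq M]
    (C T : S → ℕ) (hTC : ∀ j, T j ≤ C j) (g : ℝ) (hg : 0 ≤ g)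
    (ρ : M → ℝ) (hρ : ∀ k, 0 ≤ ρ k)
    (v : M → S → ℝ) (hv : ∀ k j, 0 ≤ v k j)
    (i : M)
    (h : ℝ)
    (hh : IsGreatest
      {w : ℝ | ∃ x : M → S → ℝ, IsIntegralAlloc x ∧ IsAlloc C x ∧ (∀ j, x i j = 0) ∧ W ρ g T v x = w} h)
    (xstar : M → S → ℝ) (hx1 : IsIntegralAlloc xstar) (hx2 : IsAlloc C xstar)
    (hopt : ∀ x : M → S → ℝ, IsIntegralAlloc x → IsAlloc C x → W ρ g T v x ≤ W ρ g T v xstar)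
    (p : ℝ)
    (hp : p = if 0 < ρ i then
        (1 / ρ i) *
          (h - ((∑ k ∈ Finset.univ.erase i, ρ k * val v xstar k) - g * ∑ j, cong T xstar j))
      else 0) :
    0 ≤ val v xstar i - p := by
  subst hp
  split_ifs with hi
  · obtain ⟨⟨x, hxi, hxa, -, hxw⟩, -⟩ := hh
    have hle : h ≤ W ρ g T v xstar := hxw ▸ hopt x hxi hxa
    rw [W_eq_sum_val_sub_cong, ← Finset.add_sum_erase _ _ (Finset.mem_univ i)] at hle
    rw [sub_nonneg, one_div, inv_mul_le_iff₀ hi]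
    linarith
  · rw [sub_zero]
    exact Finset.sum_nonneg fun j _ => mul_nonneg (hv i j) (hx2.1 i j)
end

section
/- (Total unimodularity of the constraint matrix, the Claim inside the proof of Theorem 3.) The coefficient matrix Z of the slot-allocation linear program is totally unimodular: every square submatrix of Z has determinant equal to −1, 0, or 1. -/
/-- The coefficient matrix `Z` of the slot-allocation LP. Rows are indexed by
`S ⊕ M ⊕ S` (slot-capacity constraints, assignment constraints, congestion-threshold
constraints) and columns by `(M × S) ⊕ S` (allocation variables `x_{ij}`, congestion
variables `w_j`). -/
def Zmat (M S : Type*) [DecidableEq M] [DecidableEq S] :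
    Matrix (S ⊕ (M ⊕ S)) ((M × S) ⊕ S) ℤ :=
  fun r c =>
    match r, c with
    | Sum.inl j, Sum.inl p => if p.2 = j then 1 else 0
    | Sum.inl _, Sum.inr _ => 0
    | Sum.inr (Sum.inl i), Sum.inl p => if p.1 = i then 1 else 0
    | Sum.inr (Sum.inl _), Sum.inr _ => 0
    | Sum.inr (Sum.inr j), Sum.inl p => if p.2 = j then 1 else 0
    | Sum.inr (Sum.inr j), Sum.inr j' => if j' = j then -1 else 0

/-- The vertex-edge incidence matrix of the bipartite multigraph in which the edge `c` joins
`a c` and `b c`. -/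
def bipartiteIncidence {α β γ : Type*} [DecidableEq α] [DecidableEq β] (a : γ → α) (b : γ → β) :
    Matrix (α ⊕ β) γ ℤ :=
  fun r c => Sum.elim (fun x => if a c = x then 1 else 0) (fun y => if b c = y then 1 else 0) r

theorem bipartiteIncidence_isTotallyUnimodular {α β γ : Type*} [DecidableEq α] [DecidableEq β]
    (a : γ → α) (b : γ → β) : (bipartiteIncidence a b).IsTotallyUnimodular := by
  intro k f g hf hg
  induction k with
  | zero => exact ⟨1, by simp⟩
  | succ k ih =>
    by_cases h : ∃ c i₀, ∀ i, i ≠ i₀ → bipartiteIncidence a b (f i) (g c) = 0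
    · -- a column with at most one nonzero entry: expand along it
      obtain ⟨c, i₀, h⟩ := h
      have hd := Matrix.det_succ_column ((bipartiteIncidence a b).submatrix f g) c
      rw [Fintype.sum_eq_single i₀ fun i hi => by simp [h i hi]] at hd
      rw [hd]
      change _ ∈ MonoidHom.mrange SignType.castHom.toMonoidHom
      refine mul_mem (mul_mem (pow_mem (MonoidHom.mem_mrange.2 ⟨-1, by simp⟩) _) ?_) ?_
      · rw [Matrix.submatrix_apply]
        rcases f i₀ with x | y
        · by_cases hx : a (g c) = x
          · exact ⟨1, by simp [bipartiteIncidence, hx]⟩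
          · exact ⟨0, by simp [bipartiteIncidence, hx]⟩
        · by_cases hy : b (g c) = y
          · exact ⟨1, by simp [bipartiteIncidence, hy]⟩
          · exact ⟨0, by simp [bipartiteIncidence, hy]⟩
      · exact ih _ _ (hf.comp Fin.succAbove_right_injective)
          (hg.comp Fin.succAbove_right_injective)
    · -- every column meets both sides: the signed sum of the rows vanishes
      push Not at h
      refine ⟨0, ?_⟩
      rw [SignType.coe_zero, eq_comm, ← Matrix.exists_vecMul_eq_zero_iff]
      refine ⟨fun i => Sum.elim (fun _ => 1) (fun _ => -1) (f i), fun h0 => ?_, ?_⟩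
      · have := congrFun h0 0
        rcases hf0 : f 0 with x | y <;> simp [hf0] at this
      · ext c
        obtain ⟨i, -, hi⟩ := h c 0
        obtain ⟨j, hji, hj⟩ := h c i
        have hcol : ∀ l, bipartiteIncidence a b (f l) (g c) ≠ 0 →
            f l = Sum.inl (a (g c)) ∨ f l = Sum.inr (b (g c)) := by
          intro l hl
          rcases hfl : f l with x | y <;> simp_all [bipartiteIncidence]
        have hother : ∀ l, l ≠ i ∧ l ≠ j → bipartiteIncidence a b (f l) (g c) = 0 := by
          rintro l ⟨hli, hlj⟩
          by_contra hl
          have h₁ := hf.ne hli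
          have h₂ := hf.ne hlj
          have h₃ := hf.ne hji
          rcases hcol l hl with e | e <;> rcases hcol i hi with e' | e' <;>
            rcases hcol j hj with e'' | e'' <;> simp_all
        simp only [Matrix.vecMul, dotProduct, Matrix.submatrix_apply, Pi.zero_apply]
        rw [Fintype.sum_eq_add i j hji.symm fun l hl => by rw [hother l hl, mul_zero]]
        have h₃ := hf.ne hji
        rcases hcol i hi with e' | e' <;> rcases hcol j hj with e'' | e'' <;>
          simp_all [bipartiteIncidence]

theorem Zmat_isTotallyUnimodular (M S : Type*) [DecidableEq M] [DecidableEq S] :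
    (Zmat M S).IsTotallyUnimodular := by
  have hB := ((bipartiteIncidence_isTotallyUnimodular (γ := M × S) Prod.snd Prod.fst).submatrix
    (Sum.elim Sum.inl (Sum.elim Sum.inr Sum.inl) : S ⊕ (M ⊕ S) → S ⊕ M) id).transpose
  have hZ := (hB.fromRows_unitlike
    (B := Matrix.of fun j : S => Pi.single (Sum.inr (Sum.inr j)) (-1)) fun _ j =>
      ⟨Sum.inr (Sum.inr j), -1, by ext; simp⟩).transpose
  convert hZ using 1
  ext r c
  rcases r with j | i | j <;> rcases c with p | j' <;>
    simp [Zmat, bipartiteIncidence, Matrix.transpose_apply, Pi.single_apply, eq_comm]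

/-- The Claim inside the proof of Theorem 3: the constraint matrix `Z` of the
slot-allocation LP is totally unimodular: every square submatrix of `Z` has
determinant `-1`, `0`, or `1`. -/
theorem Zmat_totally_unimodular (M S : Type*) [DecidableEq M] [DecidableEq S] :
    ∀ (k : ℕ) (f : Fin k → S ⊕ (M ⊕ S)) (g : Fin k → (M × S) ⊕ S),
      Function.Injective f → Function.Injective g →
      ((Zmat M S).submatrix f g).det ∈ ({-1, 0, 1} : Set ℤ) := by
  intro k f g hf hg
  obtain ⟨s, hs⟩ := Zmat_isTotallyUnimodular M S k f g hf hg
  rw [← hs]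
  cases s <;> simp
end

section
/- (Ghouila–Houri partition condition for the constraint matrix, as verified in the proof of Theorem 3.) For every subset R of the row indices of the matrix Z, there exists a partition of R into two disjoint subsets R₁ and R₂ such that for every column index c of Z, the signed sum Σ_{r∈R₁} Z(r, c) − Σ_{r∈R₂} Z(r, c) belongs to {−1, 0, 1}. -/
/-- Rows of `R` with positive sign: the slot-capacity rows, and the congestion rows whose
slot-capacity row is not in `R`. -/
def positiveRow {M S : Type*} (R : Finset (S ⊕ (M ⊕ S))) : S ⊕ (M ⊕ S) → Prop
  | Sum.inl _ => True
  | Sum.inr (Sum.inl _) => False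
  | Sum.inr (Sum.inr j) => Sum.inl j ∉ R

/-- Ghouila–Houri partition condition for the constraint matrix `Z`: every subset `R`
of rows can be partitioned into `R₁` and `R₂` so that for every column `c` the signed
sum of entries is in `{-1, 0, 1}`. -/
theorem Zmat_ghouila_houri (M S : Type*) [DecidableEq M] [DecidableEq S]
    [Fintype M] [Fintype S] :
    ∀ R : Finset (S ⊕ (M ⊕ S)), ∃ R₁ R₂ : Finset (S ⊕ (M ⊕ S)),
      Disjoint R₁ R₂ ∧ R₁ ∪ R₂ = R ∧
      ∀ c : (M × S) ⊕ S,
        (∑ r ∈ R₁, Zmat M S r c) - (∑ r ∈ R₂, Zmat M S r c) ∈ ({-1, 0, 1} : Set ℤ) := by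
  classical
  intro R
  refine ⟨R.filter (positiveRow R), R.filter (fun r => ¬ positiveRow R r),
    Finset.disjoint_filter_filter_not _ _ _, Finset.filter_union_filter_not_eq _ _, ?_⟩
  intro c
  have signed_sum : (∑ r ∈ R.filter (positiveRow R), Zmat M S r c)
      - (∑ r ∈ R.filter (fun r => ¬ positiveRow R r), Zmat M S r c)
      = ∑ r, if r ∈ R then (if positiveRow R r then Zmat M S r c else -Zmat M S r c) else 0 := by
    rw [Finset.sum_ite_mem, Finset.univ_inter, Finset.sum_filter, Finset.sum_filter,
      ← Finset.sum_sub_distrib]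
    refine Finset.sum_congr rfl fun r _ => ?_
    by_cases h : positiveRow R r <;> simp [h]
  rw [signed_sum, Fintype.sum_sum_type, Fintype.sum_sum_type]
  rcases c with ⟨i, j⟩ | j
  · rw [Fintype.sum_eq_single j (by intro x hx; simp [Zmat, hx.symm]),
      Fintype.sum_eq_single i (by intro x hx; simp [Zmat, hx.symm]),
      Fintype.sum_eq_single j (by intro x hx; simp [Zmat, hx.symm])]
    by_cases h₁ : Sum.inl j ∈ R <;> by_cases h₂ : Sum.inr (Sum.inl i) ∈ R <;>
      by_cases h₃ : Sum.inr (Sum.inr j) ∈ R <;> simp [Zmat, positiveRow, h₁, h₂, h₃]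
  · rw [Fintype.sum_eq_zero _ (by intro x; simp [Zmat]),
      Fintype.sum_eq_zero _ (by intro x; simp [Zmat]),
      Fintype.sum_eq_single j (by intro x hx; simp [Zmat, hx.symm])]
    by_cases h₁ : Sum.inl j ∈ R <;>
      by_cases h₃ : Sum.inr (Sum.inr j) ∈ R <;> simp [Zmat, positiveRow, h₁, h₃]
end

section
/- (Integrality of the LP relaxation, Theorem 3.) There exists an integral allocation x* (all entries in {0,1}) such that W(v, x*) ≥ W(v, x) for every fractional allocation x. In other words, the linear-programming relaxation of the SEAM slot-allocation integer program has a 0–1 optimal solution, so the optimal value of the integer program equals that of its LP relaxation. -/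
open Finset

variable {M S : Type*} [Fintype M] [Fintype S]

/-- A doubly substochastic matrix `y` sits as the off-diagonal block of a doubly stochastic one. -/
lemma IsAlloc.fromBlocks_mem_doublyStochastic {A B : Type*} [Fintype A] [Fintype B]
    [DecidableEq A] [DecidableEq B] {y : A → B → ℝ} (hy : IsAlloc (fun _ ↦ 1) y) :
    Matrix.fromBlocks (Matrix.diagonal fun i ↦ 1 - ∑ u, y i u) (Matrix.of y)
      (Matrix.of y).transpose (Matrix.diagonal fun u ↦ 1 - ∑ i, y i u) ∈
      doublyStochastic ℝ (A ⊕ B) := by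
  obtain ⟨h0, hr, hc⟩ := hy
  simp only [Nat.cast_one] at hc
  rw [mem_doublyStochastic_iff_sum]
  refine ⟨?_, ?_, ?_⟩
  · rintro (i | u) (i' | u')
    · by_cases h : i = i'
      · subst h; simpa using hr i
      · simp [h]
    · simpa using h0 i u'
    · simpa using h0 i' u
    · by_cases h : u = u'
      · subst h; simpa using hc u
      · simp [h]
  · rintro (i | u) <;> simp [Fintype.sum_sum_type, Matrix.diagonal_apply]
  · rintro (i | u) <;> simp [Fintype.sum_sum_type, Matrix.diagonal_apply]

lemma Equiv.Perm.isAlloc_permMatrix {A B : Type*} [Fintype A] [Fintype B]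
    [DecidableEq A] [DecidableEq B] (σ : Equiv.Perm (A ⊕ B)) :
    IsAlloc (fun _ ↦ 1) fun i u ↦ σ.permMatrix ℝ (Sum.inl i) (Sum.inr u) := by
  have hσ : σ.permMatrix ℝ ∈ doublyStochastic ℝ (A ⊕ B) := permMatrix_mem_doublyStochastic
  refine ⟨fun i u ↦ nonneg_of_mem_doublyStochastic hσ, fun i ↦ ?_, fun u ↦ ?_⟩
  · have h := sum_row_of_mem_doublyStochastic hσ (Sum.inl i)
    rw [Fintype.sum_sum_type] at h
    have h' : 0 ≤ ∑ i', σ.permMatrix ℝ (Sum.inl i) (Sum.inl i') :=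
      sum_nonneg fun _ _ ↦ nonneg_of_mem_doublyStochastic hσ
    linarith
  · have h := sum_col_of_mem_doublyStochastic hσ (Sum.inr u)
    rw [Fintype.sum_sum_type] at h
    have h' : 0 ≤ ∑ u', σ.permMatrix ℝ (Sum.inr u') (Sum.inr u) :=
      sum_nonneg fun _ _ ↦ nonneg_of_mem_doublyStochastic hσ
    rw [Nat.cast_one]
    linarith

/-- A linear functional on doubly substochastic matrices is maximized at an integral one. -/
lemma exists_nat_isAlloc_one_isMax {A B : Type*} [Fintype A] [Fintype B] (w : A → B → ℝ) :
    ∃ n : A → B → ℕ, IsAlloc (fun _ ↦ 1) (fun i u ↦ (n i u : ℝ)) ∧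
      ∀ y : A → B → ℝ, IsAlloc (fun _ ↦ 1) y →
        ∑ i, ∑ u, w i u * y i u ≤ ∑ i, ∑ u, w i u * n i u := by
  classical
  let F : Equiv.Perm (A ⊕ B) → ℝ := fun σ ↦
    ∑ i, ∑ u, w i u * σ.permMatrix ℝ (Sum.inl i) (Sum.inr u)
  obtain ⟨σ, hσ⟩ := Finite.exists_max F
  have hn : ∀ i u, ((σ.permMatrix ℕ (Sum.inl i) (Sum.inr u) : ℕ) : ℝ) =
      σ.permMatrix ℝ (Sum.inl i) (Sum.inr u) := fun i u ↦ by
    simp [PEquiv.toMatrix_apply]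
  refine ⟨fun i u ↦ σ.permMatrix ℕ (Sum.inl i) (Sum.inr u), ?_, fun y hy ↦ ?_⟩
  · simpa only [hn] using σ.isAlloc_permMatrix
  · simp only [hn]
    obtain ⟨c, hc0, hc1, hc⟩ :=
      exists_eq_sum_perm_of_mem_doublyStochastic hy.fromBlocks_mem_doublyStochastic
    have hyc : ∀ i u, y i u = ∑ τ, c τ * τ.permMatrix ℝ (Sum.inl i) (Sum.inr u) := fun i u ↦ by
      have h := congrFun (congrFun hc (Sum.inl i)) (Sum.inr u)
      rw [Matrix.sum_apply] at h
      simpa using h.symm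
    calc ∑ i, ∑ u, w i u * y i u = ∑ τ, c τ * F τ := by
          simp only [hyc, F, mul_sum]
          rw [sum_congr rfl fun i _ ↦ sum_comm, sum_comm]
          exact sum_congr rfl fun _ _ ↦ sum_congr rfl fun _ _ ↦ sum_congr rfl fun _ _ ↦ by ring
      _ ≤ ∑ τ, c τ * F σ := sum_le_sum fun τ _ ↦ mul_le_mul_of_nonneg_left (hσ τ) (hc0 τ)
      _ = F σ := by rw [← sum_mul, hc1, one_mul]

/-- A load `L ≤ T + D` spreads over `T` regular and `D` congested unit places, each receiving the
proportion `a`, respectively `b`, so that only the excess over `T` is congested. -/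
lemma exists_unit_proportions (T D : ℕ) {L : ℝ} (hL : 0 ≤ L) (hLTD : L ≤ T + D) :
    ∃ a b : ℝ, 0 ≤ a ∧ 0 ≤ b ∧ L * a ≤ 1 ∧ L * b ≤ 1 ∧ (L = 0 ∨ T * a + D * b = 1) ∧
      D * b * L = max (L - T) 0 := by
  rcases hL.eq_or_lt with rfl | hL
  · exact ⟨0, 0, by simp⟩
  rcases le_or_gt L T with h | h
  · have hT : (0 : ℝ) < T := hL.trans_le h
    refine ⟨1 / T, 0, by positivity, le_rfl, ?_, by simp, ?_, ?_⟩
    · rw [mul_one_div, div_le_one hT]; exact h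
    · right; field_simp; simp
    · rw [max_eq_right (by linarith)]; simp
  · have hD : (0 : ℝ) < D := by linarith
    have hLT : 0 < L - T := by linarith
    refine ⟨1 / L, (L - T) / (D * L), by positivity, by positivity, ?_, ?_, ?_, ?_⟩
    · rw [mul_one_div_cancel hL.ne']
    · rw [show L * ((L - T) / (D * L)) = (L - T) / D by field_simp, div_le_one hD]; linarith
    · right; field_simp; ring
    · rw [max_eq_left hLT.le]; field_simp

/-- The unit places of the slots: `T j` regular and `C j - T j` congested ones in slot `j`. -/
abbrev SlotUnit (C T : S → ℕ) : Type _ := (Σ j, Fin (T j)) ⊕ (Σ j, Fin (C j - T j))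

/-- The value of a movement in a unit place, where `r` is its weighted valuation of the slots. -/
def unitWeight (C T : S → ℕ) (g : ℝ) (r : M → S → ℝ) (i : M) : SlotUnit C T → ℝ :=
  Sum.elim (fun u ↦ r i u.1) (fun u ↦ r i u.1 - g)

lemma IsAlloc.exists_unit_alloc {C T : S → ℕ} (hTC : ∀ j, T j ≤ C j) (g : ℝ) (ρ : M → ℝ)
    (v : M → S → ℝ) {x : M → S → ℝ} (hx : IsAlloc C x) :
    ∃ y : M → SlotUnit C T → ℝ, IsAlloc (fun _ ↦ 1) y ∧
      W ρ g T v x = ∑ i, ∑ u, unitWeight C T g (fun i j ↦ ρ i * v i j) i u * y i u := by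
  obtain ⟨h0, hr, hc⟩ := hx
  have hL : ∀ j, 0 ≤ ∑ i, x i j := fun j ↦ sum_nonneg fun i _ ↦ h0 i j
  choose a b ha hb hLa hLb hab hcong using fun j ↦
    exists_unit_proportions (T j) (C j - T j) (hL j)
      ((hc j).trans_eq (by rw [Nat.cast_sub (hTC j)]; ring))
  have hx : ∀ i j, x i j * (T j * a j + (C j - T j : ℕ) * b j) = x i j := fun i j ↦ by
    rcases hab j with h | h
    · have := (sum_eq_zero_iff_of_nonneg fun i _ ↦ h0 i j).1 h i (mem_univ i)
      simp [this]
    · rw [h, mul_one]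
  refine ⟨fun i ↦ Sum.elim (fun u ↦ x i u.1 * a u.1) (fun u ↦ x i u.1 * b u.1), ⟨?_, ?_, ?_⟩, ?_⟩
  · rintro i (u | u)
    · exact mul_nonneg (h0 _ _) (ha _)
    · exact mul_nonneg (h0 _ _) (hb _)
  · intro i
    refine le_of_eq_of_le ?_ (hr i)
    simp only [Fintype.sum_sum_type, Fintype.sum_sigma, Sum.elim_inl, Sum.elim_inr, sum_const,
      card_univ, Fintype.card_fin, nsmul_eq_mul, ← sum_add_distrib]
    refine sum_congr rfl fun j _ ↦ ?_
    linear_combination hx i j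
  · rintro (u | u)
    · simpa [← sum_mul] using hLa u.1
    · simpa [← sum_mul] using hLb u.1
  · simp only [W, cong, unitWeight, Fintype.sum_sum_type, Fintype.sum_sigma, Sum.elim_inl,
      Sum.elim_inr, sum_const, card_univ, Fintype.card_fin, nsmul_eq_mul, ← sum_add_distrib,
      ← hcong]
    rw [sum_comm (s := (univ : Finset M)), mul_sum, ← sum_sub_distrib]
    refine sum_congr rfl fun j _ ↦ ?_
    rw [mul_sum, mul_sum, ← sum_sub_distrib]
    refine sum_congr rfl fun i _ ↦ ?_
    linear_combination (-(ρ i * v i j)) * hx i j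

/-- The allocation of movements to slots induced by an allocation to unit places. -/
def mergeUnits {C T : S → ℕ} {R : Type*} [AddCommMonoid R] (y : M → SlotUnit C T → R)
    (i : M) (j : S) : R :=
  ∑ k, y i (Sum.inl ⟨j, k⟩) + ∑ k, y i (Sum.inr ⟨j, k⟩)

section mergeUnits

variable {C T : S → ℕ} {y : M → SlotUnit C T → ℝ}

lemma IsAlloc.sum_inl_le (hy : IsAlloc (fun _ ↦ 1) y) (j : S) :
    ∑ i, ∑ k, y i (Sum.inl ⟨j, k⟩) ≤ T j := by
  rw [sum_comm]
  exact (sum_le_sum fun k _ ↦ hy.2.2 (Sum.inl ⟨j, k⟩)).trans_eq (by simp)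

lemma IsAlloc.sum_inr_le (hy : IsAlloc (fun _ ↦ 1) y) (j : S) :
    ∑ i, ∑ k, y i (Sum.inr ⟨j, k⟩) ≤ (C j - T j : ℕ) := by
  rw [sum_comm]
  exact (sum_le_sum fun k _ ↦ hy.2.2 (Sum.inr ⟨j, k⟩)).trans_eq (by simp)

lemma IsAlloc.mergeUnits (hTC : ∀ j, T j ≤ C j) (hy : IsAlloc (fun _ ↦ 1) y) :
    IsAlloc C (mergeUnits y) := by
  refine ⟨fun i j ↦ add_nonneg (sum_nonneg fun _ _ ↦ hy.1 _ _) (sum_nonneg fun _ _ ↦ hy.1 _ _),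
    fun i ↦ ?_, fun j ↦ ?_⟩
  · refine le_of_eq_of_le ?_ (hy.2.1 i)
    simp only [_root_.mergeUnits, Fintype.sum_sum_type, Fintype.sum_sigma, sum_add_distrib]
  · have h := hy.sum_inr_le j
    rw [Nat.cast_sub (hTC j)] at h
    simp only [_root_.mergeUnits, sum_add_distrib]
    linarith [hy.sum_inl_le j]

lemma IsAlloc.le_W_mergeUnits (hy : IsAlloc (fun _ ↦ 1) y) {g : ℝ} (hg : 0 ≤ g) (ρ : M → ℝ)
    (v : M → S → ℝ) :
    ∑ i, ∑ u, unitWeight C T g (fun i j ↦ ρ i * v i j) i u * y i u ≤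
      W ρ g T v (_root_.mergeUnits y) := by
  have hcong : ∀ j, cong T (_root_.mergeUnits y) j ≤ ∑ i, ∑ k, y i (Sum.inr ⟨j, k⟩) := by
    intro j
    refine max_le ?_ (sum_nonneg fun _ _ ↦ sum_nonneg fun _ _ ↦ hy.1 _ _)
    simp only [_root_.mergeUnits, sum_add_distrib]
    linarith [hy.sum_inl_le j]
  refine le_trans (le_of_eq ?_) (sub_le_sub_left
    (mul_le_mul_of_nonneg_left (sum_le_sum fun j _ ↦ hcong j) hg) _)
  simp only [unitWeight, Fintype.sum_sum_type, Fintype.sum_sigma, Sum.elim_inl, Sum.elim_inr,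
    ← sum_add_distrib, ← mul_sum, _root_.mergeUnits]
  rw [sum_comm (s := (univ : Finset M)), mul_sum, ← sum_sub_distrib]
  refine sum_congr rfl fun j _ ↦ ?_
  rw [mul_sum, ← sum_sub_distrib]
  exact sum_congr rfl fun i _ ↦ by ring

end mergeUnits

lemma IsAlloc.isIntegralAlloc_natCast {C : S → ℕ} {n : M → S → ℕ}
    (hn : IsAlloc C fun i j ↦ (n i j : ℝ)) : IsIntegralAlloc fun i j ↦ (n i j : ℝ) := by
  intro i j
  have h : (n i j : ℝ) ≤ 1 :=
    (single_le_sum (fun j _ ↦ hn.1 i j) (mem_univ j)).trans (hn.2.1 i)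
  have h' : n i j ≤ 1 := by exact_mod_cast h
  rcases Nat.le_one_iff_eq_zero_or_eq_one.1 h' with h | h <;> simp [h]

/-- Theorem 3 (integrality of the LP relaxation): there is a 0–1 allocation whose
affine social welfare dominates that of every fractional allocation. -/
theorem lp_relaxation_integral_optimum
    [Nonempty M]
    (C T : S → ℕ) (hTC : ∀ j, T j ≤ C j) (g : ℝ) (hg : 0 ≤ g)
    (ρ : M → ℝ) (hρ : ∀ k, 0 ≤ ρ k)
    (v : M → S → ℝ) (hv : ∀ k j, 0 ≤ v k j) :
    ∃ xstar : M → S → ℝ, IsIntegralAlloc xstar ∧ IsAlloc C xstar ∧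
      ∀ x : M → S → ℝ, IsAlloc C x → W ρ g T v x ≤ W ρ g T v xstar := by
  obtain ⟨n, hn, hmax⟩ :=
    exists_nat_isAlloc_one_isMax (unitWeight C T g fun i j ↦ ρ i * v i j)
  have hmerge : mergeUnits (fun i u ↦ (n i u : ℝ)) = fun i j ↦ ((mergeUnits n i j : ℕ) : ℝ) := by
    ext i j
    simp [mergeUnits]
  have halloc := hn.mergeUnits hTC
  refine ⟨mergeUnits fun i u ↦ (n i u : ℝ), ?_, halloc, fun x hx ↦ ?_⟩
  · rw [hmerge] at halloc ⊢
    exact halloc.isIntegralAlloc_natCast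
  · obtain ⟨y, hy, hxy⟩ := hx.exists_unit_alloc hTC g ρ v
    exact (hxy.trans_le (hmax y hy)).trans (hn.le_W_mergeUnits hg ρ v)
end

section
/- (Lemma 1, forward direction: b-matching optimality implies LP optimality.) Assume g > 0 and all v_{ij} ≥ 0. Let (y*, z*) be an optimal solution of the integral b-matching problem, and define x* : M × S → ℝ by x*_{ij} = y*_{ij}. Then x* is a fractional allocation maximizing the affine social welfare W(v, ·) over all fractional allocations x. -/
open Finset

variable {M S : Type*} [Fintype M] [Fintype S]

/-- Feasibility for the integral b-matching problem: `Σ_j y_{ij} ≤ 1`,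
`Σ_i y_{ij} + z_j ≤ C_j`, and `z_j ≤ C_j - T_j`. -/
def BFeasible (C T : S → ℕ) (y : M → S → ℕ) (z : S → ℕ) : Prop :=
  (∀ i, ∑ j, y i j ≤ 1) ∧ (∀ j, (∑ i, y i j) + z j ≤ C j) ∧ (∀ j, z j ≤ C j - T j)

/-- Objective of the b-matching problem:
`B(y,z) = Σ_j Σ_i ρ_i v_{ij} y_{ij} + g Σ_j z_j`. -/
noncomputable def Bobj (ρ : M → ℝ) (g : ℝ) (v : M → S → ℝ) (y : M → S → ℕ) (z : S → ℕ) : ℝ :=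
  (∑ j, ∑ i, ρ i * v i j * (y i j : ℝ)) + g * ∑ j, (z j : ℝ)

/-- A linear functional on doubly substochastic matrices is dominated by its value at some partial
permutation matrix. -/
theorem exists_partialPerm_sum_mul_ge {R K : Type*} [Fintype R] [Fintype K]
    (A w : R → K → ℝ) (hA : ∀ r k, 0 ≤ A r k) (hrow : ∀ r, ∑ k, A r k ≤ 1)
    (hcol : ∀ k, ∑ r, A r k ≤ 1) :
    ∃ P : R → K → ℕ, (∀ r, ∑ k, P r k ≤ 1) ∧ (∀ k, ∑ r, P r k ≤ 1) ∧
      ∑ r, ∑ k, w r k * A r k ≤ ∑ r, ∑ k, w r k * (P r k : ℝ) := by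
  classical
  let N : Matrix (R ⊕ K) (R ⊕ K) ℝ :=
    Matrix.fromBlocks (Matrix.diagonal fun r => 1 - ∑ k, A r k) (Matrix.of A)
      (Matrix.of A).transpose (Matrix.diagonal fun k => 1 - ∑ r, A r k)
  have hN : N ∈ doublyStochastic ℝ (R ⊕ K) := by
    rw [mem_doublyStochastic_iff_sum]
    refine ⟨?_, ?_, ?_⟩
    · rintro (r | k) (r' | k')
      · simp only [N, Matrix.fromBlocks_apply₁₁, Matrix.diagonal_apply]
        split_ifs
        · linarith [hrow r]
        · exact le_rfl
      · exact hA r k'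
      · exact hA r' k
      · simp only [N, Matrix.fromBlocks_apply₂₂, Matrix.diagonal_apply]
        split_ifs
        · linarith [hcol k]
        · exact le_rfl
    · rintro (r | k) <;> simp [N, Fintype.sum_sum_type, Matrix.diagonal_apply]
    · rintro (r | k) <;> simp [N, Fintype.sum_sum_type, Matrix.diagonal_apply]
  obtain ⟨c, hc0, hc1, hcN⟩ := exists_eq_sum_perm_of_mem_doublyStochastic hN
  let P : Equiv.Perm (R ⊕ K) → R → K → ℕ := fun σ r k => if σ (.inl r) = .inr k then 1 else 0
  let L : Equiv.Perm (R ⊕ K) → ℝ := fun σ => ∑ r, ∑ k, w r k * (P σ r k : ℝ)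
  have hAP : ∀ r k, A r k = ∑ σ, c σ * (P σ r k : ℝ) := by
    intro r k
    have h := congrFun (congrFun hcN (.inl r)) (.inr k)
    simp only [Matrix.sum_apply, Matrix.smul_apply, smul_eq_mul, N, Matrix.fromBlocks_apply₁₂,
      Matrix.of_apply] at h
    rw [← h]
    refine Finset.sum_congr rfl fun σ _ => ?_
    simp [P, Equiv.Perm.permMatrix, PEquiv.toMatrix_apply, eq_comm]
  obtain ⟨σ, hσ⟩ := Finite.exists_max L
  refine ⟨P σ, fun r => ?_, fun k => ?_, ?_⟩
  · simp only [P, Finset.sum_boole, Nat.cast_id]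
    refine Finset.card_le_one.2 fun a ha b hb => ?_
    simp only [Finset.mem_filter, Finset.mem_univ, true_and] at ha hb
    exact Sum.inr_injective (ha.symm.trans hb)
  · simp only [P, Finset.sum_boole, Nat.cast_id]
    refine Finset.card_le_one.2 fun a ha b hb => ?_
    simp only [Finset.mem_filter, Finset.mem_univ, true_and] at ha hb
    exact Sum.inl_injective (σ.injective (ha.trans hb.symm))
  · calc ∑ r, ∑ k, w r k * A r k = ∑ τ, c τ * L τ := by
          simp only [hAP, L, Finset.mul_sum]
          simp_rw [Finset.sum_comm (s := (univ : Finset K)) (t := univ (α := Equiv.Perm (R ⊕ K)))]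
          rw [Finset.sum_comm]
          refine Finset.sum_congr rfl fun τ _ => Finset.sum_congr rfl fun r _ =>
            Finset.sum_congr rfl fun k _ => by ring
      _ ≤ ∑ τ, c τ * L σ := by gcongr with τ; exacts [hc0 τ, hσ τ]
      _ = L σ := by rw [← Finset.sum_mul, hc1, one_mul]

/-- Every fractional solution of the b-matching relaxation is dominated by an integral one. -/
theorem exists_bFeasible_Bobj_ge (C T : S → ℕ) (g : ℝ) (ρ : M → ℝ) (v x : M → S → ℝ) (u : S → ℝ)
    (hx : ∀ i j, 0 ≤ x i j) (hrow : ∀ i, ∑ j, x i j ≤ 1) (hu : ∀ j, 0 ≤ u j)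
    (hcol : ∀ j, ∑ i, x i j + u j ≤ C j) (huT : ∀ j, u j ≤ (C j - T j : ℕ)) :
    ∃ y z, BFeasible C T y z ∧
      (∑ j, ∑ i, ρ i * v i j * x i j) + g * ∑ j, u j ≤ Bobj ρ g v y z := by
  classical
  let D : S → ℕ := fun j => C j - T j
  let A : M ⊕ (Σ j, Fin (D j)) → (Σ j, Fin (C j)) → ℝ := fun r k =>
    Sum.elim (fun i => x i k.1 / C k.1) (fun l => if l.1 = k.1 then u k.1 / D k.1 / C k.1 else 0) r
  let w : M ⊕ (Σ j, Fin (D j)) → (Σ j, Fin (C j)) → ℝ := fun r k =>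
    Sum.elim (fun i => ρ i * v i k.1) (fun l => if l.1 = k.1 then g else 0) r
  have hsum : ∀ j, 0 ≤ ∑ i, x i j := fun j => Finset.sum_nonneg fun i _ => hx i j
  have hxC : ∀ i j, (C j : ℝ) * (x i j / C j) = x i j := by
    intro i j
    refine mul_div_cancel_of_imp' fun h => ?_
    have := Finset.single_le_sum (f := fun i => x i j) (fun i _ => hx i j) (Finset.mem_univ i)
    linarith [hx i j, hcol j, hu j]
  have huD : ∀ j, (D j : ℝ) * (u j / D j) = u j := fun j =>
    mul_div_cancel_of_imp' fun h => by
      have := huT j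
      change u j ≤ (D j : ℝ) at this
      linarith [hu j]
  have huC : ∀ j, (C j : ℝ) * (u j / D j / C j) = u j / D j := fun j =>
    mul_div_cancel_of_imp' fun h => by
      have : u j = 0 := by linarith [hu j, hcol j, hsum j]
      simp [this]
  obtain ⟨P, hPr, hPc, hP⟩ := exists_partialPerm_sum_mul_ge A w
    (by
      rintro (i | l) k
      · exact div_nonneg (hx _ _) (Nat.cast_nonneg _)
      · simp only [A, Sum.elim_inr]
        split_ifs
        · have := hu k.1
          positivity
        · exact le_rfl)
    (by
      rintro (i | l)
      · simpa [A, Fintype.sum_sigma, hxC] using hrow i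
      · have : u l.1 / D l.1 ≤ 1 := div_le_one_of_le₀ (huT l.1) (Nat.cast_nonneg _)
        simpa [A, Fintype.sum_sigma, huC] using this)
    (by
      intro k
      have : (∑ i, x i k.1 + u k.1) / C k.1 ≤ 1 :=
        div_le_one_of_le₀ (hcol k.1) (Nat.cast_nonneg _)
      have h2 : (D k.1 : ℝ) * (u k.1 / D k.1 / C k.1) = u k.1 / C k.1 := by
        rw [← mul_div_assoc, huD]
      rw [Fintype.sum_sum_type, Fintype.sum_sigma,
        Finset.sum_eq_single k.1 (fun j _ hj => by simp [A, hj]) (by simp)]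
      simpa [A, h2, ← Finset.sum_div, ← add_div] using this)
  refine ⟨fun i j => ∑ k, P (.inl i) ⟨j, k⟩, fun j => ∑ l, ∑ k, P (.inr ⟨j, l⟩) ⟨j, k⟩,
    ⟨fun i => ?_, fun j => ?_, fun j => ?_⟩, ?_⟩
  · simpa [Fintype.sum_sigma] using hPr (.inl i)
  · calc _ = ∑ k, (∑ i, P (.inl i) ⟨j, k⟩ + ∑ l, P (.inr ⟨j, l⟩) ⟨j, k⟩) := by
          rw [Finset.sum_add_distrib, Finset.sum_comm]
          exact congrArg _ Finset.sum_comm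
      _ ≤ ∑ _k : Fin (C j), 1 := by
          refine Finset.sum_le_sum fun k _ => le_trans ?_ (hPc ⟨j, k⟩)
          rw [Fintype.sum_sum_type, Fintype.sum_sigma]
          gcongr
          exact Finset.single_le_sum (f := fun j' => ∑ l, P (.inr ⟨j', l⟩) ⟨j, k⟩)
            (fun _ _ => Nat.zero_le _) (Finset.mem_univ j)
      _ = C j := by simp
  · calc _ ≤ ∑ _l : Fin (D j), 1 := by
          refine Finset.sum_le_sum fun l _ => le_trans ?_ (hPr (.inr ⟨j, l⟩))
          rw [Fintype.sum_sigma]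
          exact Finset.single_le_sum (f := fun j' => ∑ k, P (.inr ⟨j, l⟩) ⟨j', k⟩)
            (fun _ _ => Nat.zero_le _) (Finset.mem_univ j)
      _ = C j - T j := by simp [D]
  · have hleft : ∑ r, ∑ k, w r k * A r k = (∑ j, ∑ i, ρ i * v i j * x i j) + g * ∑ j, u j := by
      rw [Fintype.sum_sum_type, Fintype.sum_sigma, Finset.mul_sum, Finset.sum_comm (s := univ (α := S))]
      congr 1
      · refine Finset.sum_congr rfl fun i _ => ?_
        simp only [w, A, Sum.elim_inl, Fintype.sum_sigma, Finset.sum_const, Finset.card_univ,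
          Fintype.card_fin, nsmul_eq_mul]
        refine Finset.sum_congr rfl fun j _ => ?_
        rw [mul_left_comm, hxC]
      · refine Finset.sum_congr rfl fun j _ => ?_
        simp [w, A, Fintype.sum_sigma]
        rw [mul_left_comm (C j : ℝ), huC, mul_left_comm, huD]
    have hright : ∑ r, ∑ k, w r k * (P r k : ℝ) =
        Bobj ρ g v (fun i j => ∑ k, P (.inl i) ⟨j, k⟩)
          (fun j => ∑ l, ∑ k, P (.inr ⟨j, l⟩) ⟨j, k⟩) := by
      rw [Bobj, Fintype.sum_sum_type, Fintype.sum_sigma, Finset.mul_sum,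
        Finset.sum_comm (s := univ (α := S))]
      congr 1
      · refine Finset.sum_congr rfl fun i _ => ?_
        simp [w, Fintype.sum_sigma, Finset.mul_sum]
      · refine Finset.sum_congr rfl fun j _ => ?_
        rw [Nat.cast_sum, Finset.mul_sum]
        refine Finset.sum_congr rfl fun l _ => ?_
        rw [Fintype.sum_sigma,
          Finset.sum_eq_single j (fun j' _ hj => by simp [w, hj.symm]) (by simp)]
        simp [w, Finset.mul_sum]
    rw [← hleft, ← hright]
    exact hP

/-- Lemma 1, forward direction: b-matching optimality implies LP optimality. -/
theorem bmatching_opt_implies_lp_opt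
    [Nonempty M]
    (C T : S → ℕ) (hTC : ∀ j, T j ≤ C j) (g : ℝ) (hg : 0 < g)
    (ρ : M → ℝ) (hρ : ∀ k, 0 ≤ ρ k)
    (v : M → S → ℝ) (hv : ∀ k j, 0 ≤ v k j)
    (ystar : M → S → ℕ) (zstar : S → ℕ)
    (hfeas : BFeasible C T ystar zstar)
    (hopt : ∀ (y : M → S → ℕ) (z : S → ℕ), BFeasible C T y z → Bobj ρ g v y z ≤ Bobj ρ g v ystar zstar) :
    IsAlloc C (fun i j => (ystar i j : ℝ)) ∧
      ∀ x : M → S → ℝ, IsAlloc C x → W ρ g T v x ≤ W ρ g T v (fun i j => (ystar i j : ℝ)) := by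
  obtain ⟨hfr, hfc, hfz⟩ := hfeas
  have hcast : ∀ j, ((C j - T j : ℕ) : ℝ) = C j - T j := fun j => Nat.cast_sub (hTC j)
  refine ⟨⟨fun i j => Nat.cast_nonneg _, fun i => by beta_reduce; exact_mod_cast hfr i,
    fun j => by beta_reduce; exact_mod_cast (Nat.le_add_right _ _).trans (hfc j)⟩, fun x ⟨hx0, hxr, hxc⟩ => ?_⟩
  have hslack : ∀ j, ((C j : ℝ) - T j) - cong T x j = min (C j - T j : ℝ) (C j - ∑ i, x i j) := by
    intro j
    rw [cong, ← min_sub_sub_left, min_comm]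
    congr 1 <;> ring
  obtain ⟨y, z, hyz, hB⟩ := exists_bFeasible_Bobj_ge C T g ρ v x
    (fun j => ((C j : ℝ) - T j) - cong T x j) hx0 hxr
    (fun j => by
      have : (T j : ℝ) ≤ C j := by exact_mod_cast hTC j
      rw [hslack]
      exact le_min (by linarith) (by linarith [hxc j]))
    (fun j => by
      rw [hslack]
      linarith [min_le_right (C j - T j : ℝ) (C j - ∑ i, x i j)])
    (fun j => by
      rw [hslack, hcast]
      exact min_le_left _ _)
  have hstar : ∑ j, (zstar j : ℝ) ≤
      ∑ j, (((C j : ℝ) - T j) - cong T (fun i j => (ystar i j : ℝ)) j) := by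
    refine Finset.sum_le_sum fun j _ => ?_
    have h1 : (∑ i, (ystar i j : ℝ)) + zstar j ≤ C j := by exact_mod_cast hfc j
    have h2 : (zstar j : ℝ) ≤ C j - T j := by
      rw [← hcast]
      exact_mod_cast hfz j
    have : cong T (fun i j => (ystar i j : ℝ)) j ≤ C j - T j - zstar j :=
      max_le (by linarith) (by linarith)
    linarith
  have hle := hB.trans (hopt y z hyz)
  have hmul := mul_le_mul_of_nonneg_left hstar hg.le
  rw [Bobj] at hle
  rw [Finset.sum_sub_distrib, mul_sub] at hle hmul
  rw [W, W]
  linarith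
end

section
/- (Lemma 1, backward direction: LP optimality implies b-matching optimality.) Assume g ≥ 0 and all v_{ij} ≥ 0. Let x* be an integral allocation (all entries in {0,1}) maximizing the affine social welfare W(v, ·) over all fractional allocations, and define z*_j = min(C_j − T_j, C_j − Σ_{i∈M} x*_{ij}) for every j ∈ S. Then (x*, z*) is a feasible pair for the integral b-matching problem and is optimal, i.e., B(x*, z*) ≥ B(y, z) for every feasible integer pair (y, z). -/
open Finset

variable {M S : Type*} [Fintype M] [Fintype S]

/-- Feasible b-matchings are allocations when read as real matrices. -/
theorem BFeasible.isAlloc {C T : S → ℕ} {y : M → S → ℕ} {z : S → ℕ} (h : BFeasible C T y z) :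
    IsAlloc C fun i j => (y i j : ℝ) := by
  refine ⟨fun i j => Nat.cast_nonneg _, fun i => ?_, fun j => ?_⟩
  · beta_reduce
    exact_mod_cast h.1 i
  · beta_reduce
    exact_mod_cast (Nat.le_add_right _ _).trans (h.2.1 j)

/-- In a feasible b-matching, dummy units and congestion of a slot sum to at most `C j - T j`. -/
theorem BFeasible.cast_add_cong_le {C T : S → ℕ} (hTC : ∀ j, T j ≤ C j) {y : M → S → ℕ}
    {z : S → ℕ} (h : BFeasible C T y z) (j : S) :
    (z j : ℝ) + cong T (fun i j => (y i j : ℝ)) j ≤ (C j : ℝ) - T j := by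
  have h₁ : (∑ i, (y i j : ℝ)) + z j ≤ C j := by exact_mod_cast h.2.1 j
  have h₂ : (z j : ℝ) ≤ (C j : ℝ) - T j := by
    rw [← Nat.cast_sub (hTC j)]
    exact_mod_cast h.2.2 j
  have h₃ : cong T (fun i j => (y i j : ℝ)) j ≤ (C j : ℝ) - T j - z j :=
    max_le (by linarith) (by linarith)
  linarith

/-- The largest feasible number of dummy units in a slot complements its congestion. -/
theorem cast_min_add_cong {ι κ : Type*} [Fintype ι] {C T : κ → ℕ} {j : κ} (hTC : T j ≤ C j)
    {y : ι → κ → ℕ} (hC : ∑ i, y i j ≤ C j) :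
    ((min (C j - T j) (C j - ∑ i, y i j) : ℕ) : ℝ) + cong T (fun i j => (y i j : ℝ)) j =
      (C j : ℝ) - T j := by
  rw [Nat.cast_min, Nat.cast_sub hTC, Nat.cast_sub hC, cong, Nat.cast_sum]
  rcases le_total (∑ i, (y i j : ℝ)) (T j) with h | h
  · rw [min_eq_left (by linarith), max_eq_right (by linarith)]
    ring
  · rw [min_eq_right (by linarith), max_eq_left (by linarith)]
    ring

/-- The b-matching objective is the welfare plus the cost of the total amount of dummy units
and congestion. -/
theorem Bobj_eq_W_add (ρ : M → ℝ) (g : ℝ) (T : S → ℕ) (v : M → S → ℝ) (y : M → S → ℕ)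
    (z : S → ℕ) :
    Bobj ρ g v y z = W ρ g T v (fun i j => (y i j : ℝ)) +
      g * ∑ j, ((z j : ℝ) + cong T (fun i j => (y i j : ℝ)) j) := by
  rw [Bobj, W, sum_add_distrib]
  ring

/-- Lemma 1, backward direction: LP optimality implies b-matching optimality. -/
theorem lp_opt_implies_bmatching_opt
    [Nonempty M]
    (C T : S → ℕ) (hTC : ∀ j, T j ≤ C j) (g : ℝ) (hg : 0 ≤ g)
    (ρ : M → ℝ) (hρ : ∀ k, 0 ≤ ρ k)
    (v : M → S → ℝ) (hv : ∀ k j, 0 ≤ v k j)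
    (xstar : M → S → ℝ) (hint : IsIntegralAlloc xstar) (halloc : IsAlloc C xstar)
    (hopt : ∀ x : M → S → ℝ, IsAlloc C x → W ρ g T v x ≤ W ρ g T v xstar)
    (ystar : M → S → ℕ) (hy : ∀ i j, (ystar i j : ℝ) = xstar i j)
    (zstar : S → ℕ) (hz : ∀ j, zstar j = min (C j - T j) (C j - ∑ i, ystar i j)) :
    BFeasible C T ystar zstar ∧
      ∀ (y : M → S → ℕ) (z : S → ℕ), BFeasible C T y z → Bobj ρ g v y z ≤ Bobj ρ g v ystar zstar := by
  obtain rfl : (fun i j => (ystar i j : ℝ)) = xstar := funext₂ hy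
  obtain ⟨-, hrow, hcol⟩ := halloc
  beta_reduce at hrow hcol
  replace hrow : ∀ i, ∑ j, ystar i j ≤ 1 := fun i => by exact_mod_cast hrow i
  replace hcol : ∀ j, ∑ i, ystar i j ≤ C j := fun j => by exact_mod_cast hcol j
  refine ⟨⟨hrow, fun j => ?_, fun j => ?_⟩, fun y z hyz => ?_⟩
  · have := hcol j
    have := hz j
    omega
  · exact (hz j).trans_le (min_le_left _ _)
  · rw [Bobj_eq_W_add ρ g T, Bobj_eq_W_add ρ g T]
    refine add_le_add (hopt _ hyz.isAlloc)
      (mul_le_mul_of_nonneg_left (sum_le_sum fun j _ => ?_) hg)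
    rw [hz j, cast_min_add_cong (hTC j) (hcol j)]
    exact hyz.cast_add_cong_le hTC j
end

section
/- (Value identity between the b-matching problem and the LP relaxation, underlying Lemma 1.) Assume g ≥ 0 and all v_{ij} ≥ 0. The maximum of B(y, z) over all feasible integer pairs (y, z) of the b-matching problem equals the supremum of the affine social welfare W(v, x) over all fractional allocations x, plus the constant g · Σ_{j∈S} (C_j − T_j). -/
open Finset

variable {M S : Type*} [Fintype M] [Fintype S]

/-- A matrix whose row and column sums are at most one is dominated, with respect to any
linear objective, by a matching. -/
theorem exists_matching_ge {L R : Type*} [Fintype L] [Fintype R]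
    (A w : L → R → ℝ) (hA : ∀ l r, 0 ≤ A l r)
    (hrow : ∀ l, ∑ r, A l r ≤ 1) (hcol : ∀ r, ∑ l, A l r ≤ 1) :
    ∃ P : L → R → ℕ, (∀ l, ∑ r, P l r ≤ 1) ∧ (∀ r, ∑ l, P l r ≤ 1) ∧
      ∑ l, ∑ r, w l r * A l r ≤ ∑ l, ∑ r, w l r * (P l r : ℝ) := by
  classical
  let D : Matrix (L ⊕ R) (L ⊕ R) ℝ := Matrix.fromBlocks
    (Matrix.diagonal fun l => 1 - ∑ r, A l r) (Matrix.of A)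
    (Matrix.of A).transpose (Matrix.diagonal fun r => 1 - ∑ l, A l r)
  have hD : D ∈ doublyStochastic ℝ (L ⊕ R) := by
    rw [mem_doublyStochastic_iff_sum]
    refine ⟨?_, ?_, ?_⟩
    · rintro (i | i) (j | j)
      · by_cases h : i = j
        · subst h; simpa [D] using hrow i
        · simp [D, h]
      · simpa [D] using hA i j
      · simpa [D] using hA j i
      · by_cases h : i = j
        · subst h; simpa [D] using hcol i
        · simp [D, h]
    · rintro (i | i) <;> simp [D, Matrix.diagonal_apply]
    · rintro (i | i) <;> simp [D, Matrix.diagonal_apply]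
  let f : Matrix (L ⊕ R) (L ⊕ R) ℝ →ₗ[ℝ] ℝ :=
    ∑ l, ∑ r, w l r • Matrix.entryLinearMap ℝ ℝ (Sum.inl l) (Sum.inr r)
  have hf (Q) : f Q = ∑ l, ∑ r, w l r * Q (Sum.inl l) (Sum.inr r) := by
    simp [f, LinearMap.sum_apply]
  rw [← SetLike.mem_coe, doublyStochastic_eq_convexHull_permMatrix] at hD
  obtain ⟨_, ⟨σ, rfl⟩, hσ⟩ :=
    (f.convexOn convex_univ).exists_ge_of_mem_convexHull (Set.subset_univ _) hD
  refine ⟨fun l r => if σ (Sum.inl l) = Sum.inr r then 1 else 0, fun l => ?_, fun r => ?_, ?_⟩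
  · rw [Finset.sum_boole, Nat.cast_id, Finset.card_le_one]
    simp only [Finset.mem_filter, Finset.mem_univ, true_and]
    intro a ha b hb
    exact Sum.inr_injective (ha.symm.trans hb)
  · rw [Finset.sum_boole, Nat.cast_id, Finset.card_le_one]
    simp only [Finset.mem_filter, Finset.mem_univ, true_and]
    intro a ha b hb
    exact Sum.inl_injective (σ.injective (ha.trans hb.symm))
  · rw [hf, hf] at hσ
    simpa [D, PEquiv.toMatrix_apply, Equiv.toPEquiv_apply, eq_comm] using hσ

/-- Filling unit cells greedily with a total amount `s`, the cells of index at least `t`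
receive the excess of `s` over `t`. -/
theorem sum_range_clamp (s : ℝ) (hs : 0 ≤ s) (t n : ℕ) :
    ∑ k ∈ range n, (if t ≤ k then min 1 (max 0 (s - k)) else 0)
      = max (min s n - t) 0 := by
  induction n with
  | zero => simp [hs]
  | succ n ih =>
    rw [Finset.sum_range_succ, ih]
    push_cast
    by_cases h : t ≤ n
    · have h' : (t : ℝ) ≤ n := by exact_mod_cast h
      rw [if_pos h]
      simp only [max_def, min_def]
      split_ifs <;> linarith
    · have h' : (n : ℝ) + 1 ≤ t := by exact_mod_cast not_le.mp h
      rw [if_neg h, add_zero, max_eq_right, max_eq_right] <;>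
        linarith [min_le_right s (n : ℝ), min_le_right s ((n : ℝ) + 1)]

/-- When `c` unit cells suffice to hold `s`, greedy filling puts exactly the excess of `s` over `t`
into the cells of index at least `t`. -/
theorem sum_fin_clamp (s : ℝ) (hs : 0 ≤ s) (t c : ℕ) (hsc : s ≤ c) :
    ∑ k : Fin c, (if t ≤ (k : ℕ) then min 1 (max 0 (s - (k : ℕ))) else 0) = max (s - t) 0 := by
  rw [Fin.sum_univ_eq_sum_range (fun k : ℕ => if t ≤ k then min 1 (max 0 (s - k)) else 0) c,
    sum_range_clamp s hs, min_eq_left hsc]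

/-- For unit cells with load at most one, the excess of the total load over `t` is at most the
load of the cells of index at least `t`. -/
theorem excess_le_sum_fin (c t : ℕ) (q : Fin c → ℝ) (hq0 : ∀ k, 0 ≤ q k) (hq1 : ∀ k, q k ≤ 1) :
    max (∑ k, q k - t) 0 ≤ ∑ k : Fin c, (if t ≤ (k : ℕ) then q k else 0) := by
  refine max_le ?_ (Finset.sum_nonneg fun k _ => by split_ifs <;> simp [hq0])
  have h : ∑ k, q k ≤ ∑ k : Fin c, ((if t ≤ (k : ℕ) then q k else 0)
      + (if (k : ℕ) < t then 1 else 0)) := by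
    refine Finset.sum_le_sum fun k _ => ?_
    rcases lt_or_ge (k : ℕ) t with h | h
    · simpa [h, not_le.mpr h] using hq1 k
    · simp [h, not_lt.mpr h]
  have h2 : ∑ k : Fin c, (if (k : ℕ) < t then (1 : ℝ) else 0) ≤ t := by
    rw [Finset.sum_boole]
    have : #{k : Fin c | (k : ℕ) < t} ≤ #(range t) :=
      Finset.card_le_card_of_injOn (fun k => (k : ℕ)) (by intro k; simp)
        (fun a _ b _ hab => Fin.ext hab)
    exact_mod_cast this.trans_eq (card_range t)
  rw [Finset.sum_add_distrib] at h
  linarith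

/-- Every fractional allocation is dominated in welfare by an integral one. -/
theorem exists_integral_W_ge (C T : S → ℕ) (g : ℝ) (hg : 0 ≤ g) (ρ : M → ℝ) (v x : M → S → ℝ)
    (hx : IsAlloc C x) :
    ∃ y : M → S → ℕ, (∀ i, ∑ j, y i j ≤ 1) ∧ (∀ j, ∑ i, y i j ≤ C j) ∧
      W ρ g T v x ≤ W ρ g T v (fun i j => (y i j : ℝ)) := by
  obtain ⟨hx0, hx1, hxC⟩ := hx
  set s : S → ℝ := fun j => ∑ i, x i j with hs
  have hs0 (j) : 0 ≤ s j := Finset.sum_nonneg fun i _ => hx0 i j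
  let a : S → ℕ → ℝ := fun j k => min 1 (max 0 (s j - k))
  have ha0 (j k) : 0 ≤ a j k := le_min zero_le_one (le_max_left _ _)
  have ha1 (j k) : a j k ≤ 1 := min_le_left _ _
  have hexc (j) (t : ℕ) :
      ∑ k : Fin (C j), (if t ≤ (k : ℕ) then a j k else 0) = max (s j - t) 0 :=
    sum_fin_clamp (s j) (hs0 j) t (C j) (hxC j)
  have hasum (j) : ∑ k : Fin (C j), a j k = s j := by
    simpa [hs0 j] using hexc j 0
  have hxs (i j) : x i j * s j / s j = x i j := by
    rcases eq_or_ne (s j) 0 with h | h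
    · have : x i j = 0 := (Finset.sum_eq_zero_iff_of_nonneg fun i _ => hx0 i j).mp h i (mem_univ i)
      simp [this]
    · exact mul_div_cancel_right₀ _ h
  have hsa (j k) : s j * a j k / s j = a j k := by
    rcases eq_or_ne (s j) 0 with h | h
    · simp [a, h]
    · exact mul_div_cancel_left₀ _ h
  let A : M → (Σ j, Fin (C j)) → ℝ := fun i p => x i p.1 * a p.1 p.2 / s p.1
  have hArow (i j) : ∑ k : Fin (C j), A i ⟨j, k⟩ = x i j := by
    simp only [A]
    rw [← Finset.sum_div, ← Finset.mul_sum, hasum, hxs]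
  have hAcol (p) : ∑ i, A i p = a p.1 p.2 := by
    simp only [A]
    rw [← Finset.sum_div, ← Finset.sum_mul]
    exact hsa _ _
  let w : M → (Σ j, Fin (C j)) → ℝ := fun i p =>
    ρ i * v i p.1 - g * (if T p.1 ≤ (p.2 : ℕ) then 1 else 0)
  have hobj (Q : M → (Σ j, Fin (C j)) → ℝ) : ∑ i, ∑ p, w i p * Q i p
      = (∑ j, ∑ i, ρ i * v i j * ∑ k : Fin (C j), Q i ⟨j, k⟩)
        - g * ∑ j, ∑ k : Fin (C j), (if T j ≤ (k : ℕ) then ∑ i, Q i ⟨j, k⟩ else 0) := by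
    simp only [Fintype.sum_sigma]
    rw [Finset.sum_comm, Finset.mul_sum, ← Finset.sum_sub_distrib]
    refine Finset.sum_congr rfl fun j _ => ?_
    have h : ∑ k : Fin (C j), (if T j ≤ (k : ℕ) then ∑ i, Q i ⟨j, k⟩ else 0)
        = ∑ i, ∑ k : Fin (C j), (if T j ≤ (k : ℕ) then Q i ⟨j, k⟩ else 0) := by
      rw [Finset.sum_comm]
      refine Finset.sum_congr rfl fun k _ => ?_
      split_ifs <;> simp
    rw [h, Finset.mul_sum, ← Finset.sum_sub_distrib]
    refine Finset.sum_congr rfl fun i _ => ?_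
    rw [Finset.mul_sum, Finset.mul_sum, ← Finset.sum_sub_distrib]
    refine Finset.sum_congr rfl fun k _ => ?_
    simp only [w]
    split_ifs <;> ring
  obtain ⟨P, hP1, hP2, hP3⟩ := exists_matching_ge A w
    (fun i p => div_nonneg (mul_nonneg (hx0 _ _) (ha0 _ _)) (hs0 _))
    (fun i => by rw [Fintype.sum_sigma]; simpa only [hArow] using hx1 i)
    (fun p => by rw [hAcol]; exact ha1 _ _)
  refine ⟨fun i j => ∑ k : Fin (C j), P i ⟨j, k⟩, fun i => ?_, fun j => ?_, ?_⟩
  · simpa only [Fintype.sum_sigma] using hP1 i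
  · rw [Finset.sum_comm]
    exact (Finset.sum_le_sum fun k _ => hP2 ⟨j, k⟩).trans (by simp)
  · rw [hobj, hobj] at hP3
    simp only [hArow, hAcol, hexc] at hP3
    refine hP3.trans ?_
    unfold W cong
    push_cast
    refine sub_le_sub_left (mul_le_mul_of_nonneg_left (Finset.sum_le_sum fun j _ => ?_) hg) _
    rw [Finset.sum_comm]
    exact excess_le_sum_fin (C j) (T j) (fun k => ∑ i, (P i ⟨j, k⟩ : ℝ))
      (fun k => Finset.sum_nonneg fun i _ => Nat.cast_nonneg _)
      (fun k => by exact_mod_cast hP2 ⟨j, k⟩)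

/-- For a fixed integral assignment, the b-matching objective is at most the welfare plus the
total slack above the thresholds. -/
theorem Bobj_le_W_add (C T : S → ℕ) (hTC : ∀ j, T j ≤ C j) (g : ℝ) (hg : 0 ≤ g) (ρ : M → ℝ)
    (v : M → S → ℝ) (y : M → S → ℕ) (z : S → ℕ) (h : BFeasible C T y z) :
    Bobj ρ g v y z ≤ W ρ g T v (fun i j => (y i j : ℝ)) + g * ∑ j, ((C j : ℝ) - (T j : ℝ)) := by
  have key : ∑ j, (z j : ℝ) + ∑ j, cong T (fun i j => (y i j : ℝ)) j
      ≤ ∑ j, ((C j : ℝ) - (T j : ℝ)) := by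
    rw [← Finset.sum_add_distrib]
    refine Finset.sum_le_sum fun j _ => ?_
    have h1 : (∑ i, (y i j : ℝ)) + z j ≤ C j := by exact_mod_cast h.2.1 j
    have h2 : (z j : ℝ) ≤ C j - T j := by
      rw [← Nat.cast_sub (hTC j)]; exact_mod_cast h.2.2 j
    unfold cong
    rcases max_cases (∑ i, (y i j : ℝ) - (T j : ℝ)) 0 with h3 | h3 <;> linarith
  have := mul_le_mul_of_nonneg_left key hg
  unfold Bobj W
  linarith

/-- Choosing the slack variables as large as possible attains the welfare plus the total slack
above the thresholds. -/
theorem exists_Bobj_eq_W_add (C T : S → ℕ) (hTC : ∀ j, T j ≤ C j) (g : ℝ) (ρ : M → ℝ)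
    (v : M → S → ℝ) (y : M → S → ℕ) (h1 : ∀ i, ∑ j, y i j ≤ 1) (h2 : ∀ j, ∑ i, y i j ≤ C j) :
    ∃ z, BFeasible C T y z ∧
      Bobj ρ g v y z = W ρ g T v (fun i j => (y i j : ℝ)) + g * ∑ j, ((C j : ℝ) - (T j : ℝ)) := by
  refine ⟨fun j => min (C j - T j) (C j - ∑ i, y i j),
    ⟨h1, fun j => ?_, fun j => min_le_left _ _⟩, ?_⟩
  · have := h2 j
    dsimp only
    omega
  · have key : ∑ j, ((min (C j - T j) (C j - ∑ i, y i j) : ℕ) : ℝ)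
        = ∑ j, ((C j : ℝ) - (T j : ℝ)) - ∑ j, cong T (fun i j => (y i j : ℝ)) j := by
      rw [← Finset.sum_sub_distrib]
      refine Finset.sum_congr rfl fun j _ => ?_
      rw [Nat.cast_min, Nat.cast_sub (hTC j), Nat.cast_sub (h2 j), Nat.cast_sum]
      unfold cong
      simp only [max_def, min_def]
      split_ifs <;> linarith
    unfold Bobj W
    rw [key]
    ring

/-- Value identity: the maximum of the b-matching objective equals the supremum of the
affine social welfare over fractional allocations plus the constant `g Σ_j (C_j - T_j)`. -/
theorem bmatching_lp_value_identity
    [Nonempty M]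
    (C T : S → ℕ) (hTC : ∀ j, T j ≤ C j) (g : ℝ) (hg : 0 ≤ g)
    (ρ : M → ℝ) (hρ : ∀ k, 0 ≤ ρ k)
    (v : M → S → ℝ) (hv : ∀ k j, 0 ≤ v k j)
    (bmax : ℝ)
    (hb : IsGreatest {b : ℝ | ∃ (y : M → S → ℕ) (z : S → ℕ), BFeasible C T y z ∧ b = Bobj ρ g v y z} bmax) :
    bmax = sSup {r : ℝ | ∃ x : M → S → ℝ, IsAlloc C x ∧ r = W ρ g T v x}
      + g * ∑ j, ((C j : ℝ) - (T j : ℝ)) := by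
  have hub : ∀ r ∈ {r : ℝ | ∃ x : M → S → ℝ, IsAlloc C x ∧ r = W ρ g T v x},
      r ≤ bmax - g * ∑ j, ((C j : ℝ) - (T j : ℝ)) := by
    rintro _ ⟨x, hx, rfl⟩
    obtain ⟨y, hy1, hy2, hy⟩ := exists_integral_W_ge C T g hg ρ v x hx
    obtain ⟨z, hz, hB⟩ := exists_Bobj_eq_W_add C T hTC g ρ v y hy1 hy2
    have := hb.2 ⟨y, z, hz, rfl⟩
    linarith
  obtain ⟨y, z, hyz, hB⟩ := hb.1
  have hmem : W ρ g T v (fun i j => (y i j : ℝ)) ∈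
      {r : ℝ | ∃ x : M → S → ℝ, IsAlloc C x ∧ r = W ρ g T v x} :=
    ⟨_, ⟨fun i j => Nat.cast_nonneg _, fun i => by exact_mod_cast hyz.1 i,
      fun j => by exact_mod_cast (Nat.le_add_right _ _).trans (hyz.2.1 j)⟩, rfl⟩
  have hle := Bobj_le_W_add C T hTC g hg ρ v y z hyz
  have h1 := le_csSup ⟨_, hub⟩ hmem
  have h2 := csSup_le ⟨_, hmem⟩ hub
  linarith
end
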